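/- arXiv:2404.01022 — 2 statements merged into one kernel-verified Lean document; each statement's English description precedes it below -/
import Mathlib

section
/- In the size-bounded construction, define q: V(G'') → [0,∞] by q(v) = ∞ for v ∈ V(G), q(a(v,u)) = w({v,u}) for every subdivision vertex a(v,u), and q(a) = 0 for every a ∈ J(v); define p: V(G'') × {1,2} → [0,∞] by p(s,2) = p(t,1) = ∞ and p(x,i) = 0 for all other pairs (x,i). Then for every r ∈ [0,∞): there exists a bipartition (V_s,V_t) of V(G) with s ∈ V_s, t ∈ V_t, |V_s| ≤ ℓ, and the total weight Σ w({v,u}) over edges {v,u} of G with one endpoint in V_s and the other in V_t at most r, if and only if there exists a bipartition (V₁,V₂) of V(G'') with |V₁| ≤ ℓ + n + d·(ℓ−1) and Σ_{v∈V₁} p(v,1) + Σ_{v∈V₂} p(v,2) + Δ((V₁,V₂),q,G'') ≤ r. -/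
open scoped Classical
open Finset

noncomputable section

/-- Subdivision vertices of `G'`: one vertex `a(v,u)` for each arc `(v,u)` of `→G`,
the orientation of `G` from the `≺`-smaller to the `≺`-larger endpoint. -/
abbrev SBArc {V : Type*} (G : SimpleGraph V) [LinearOrder V] :=
  {p : V × V // G.Adj p.1 p.2 ∧ p.1 < p.2}

/-- The vertices of `⋃_{v ∈ V(G)∖{s,t}} J(v)`: for each `v ∈ V(G) ∖ {s,t}`, the set
`J(v)` has one vertex for every in-arc of `v` in `→G` (so `|J(v)|` equals the
in-degree of `v` in `→G`). -/
abbrev SBJ {V : Type*} (G : SimpleGraph V) [LinearOrder V] (s t : V) :=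
  {p : V × V // (G.Adj p.1 p.2 ∧ p.1 < p.2) ∧ p.2 ≠ s ∧ p.2 ≠ t}

/-- Vertices of `G''`. -/
abbrev SBV {V : Type*} (G : SimpleGraph V) [LinearOrder V] (s t : V) :=
  (V ⊕ SBArc G) ⊕ SBJ G s t

/-- Arcs of `G''`: `(v, a(v,u))` and `(a(v,u), u)` for every arc `(v,u)` of `→G`,
together with an arc from `v` to every vertex of `J(v)`. -/
def sbArcRel {V : Type*} (G : SimpleGraph V) [LinearOrder V] (s t : V) :
    SBV G s t → SBV G s t → Prop
  | Sum.inl (Sum.inl v), Sum.inl (Sum.inr a) => a.1.1 = v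
  | Sum.inl (Sum.inr a), Sum.inl (Sum.inl u) => a.1.2 = u
  | Sum.inl (Sum.inl v), Sum.inr j => j.1.2 = v
  | _, _ => False

/-- Transfer cost `Δ((V₁,V₂), q, G)` of a bipartition `(V₁, V₁ᶜ)` of the vertices of a
digraph with arc relation `A`. -/
def biTransfer {W : Type*} [Fintype W] (A : W → W → Prop)
    (V1 : Set W) (q : W → ENNReal) : ENNReal :=
  (∑ v : W, if v ∈ V1 ∧ ∃ u, A v u ∧ u ∉ V1 then q v else 0)
  + (∑ v : W, if v ∉ V1 ∧ ∃ u, A v u ∧ u ∈ V1 then q v else 0)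

/-- The function `q` on `V(G'')`: `∞` on original vertices, `w({v,u})` on the
subdivision vertex `a(v,u)`, and `0` on the vertices of the sets `J(v)`. -/
def sbQ {V : Type*} (G : SimpleGraph V) [LinearOrder V] (s t : V)
    (w : Sym2 V → NNReal) : SBV G s t → ENNReal
  | Sum.inl (Sum.inl _) => ⊤
  | Sum.inl (Sum.inr a) => (w s(a.1.1, a.1.2) : ENNReal)
  | Sum.inr _ => 0

/-- `p(·, 1)` on `V(G'')`: `p(t, 1) = ∞` and `p(x, 1) = 0` for every other vertex. -/
def sbP1 {V : Type*} (G : SimpleGraph V) [LinearOrder V] (s t : V) :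
    SBV G s t → ENNReal :=
  fun x => if x = Sum.inl (Sum.inl t) then ⊤ else 0

/-- `p(·, 2)` on `V(G'')`: `p(s, 2) = ∞` and `p(x, 2) = 0` for every other vertex. -/
def sbP2 {V : Type*} (G : SimpleGraph V) [LinearOrder V] (s t : V) :
    SBV G s t → ENNReal :=
  fun x => if x = Sum.inl (Sum.inl s) then ⊤ else 0

theorem Fintype.sum_subtype_eq_sum_sum_ite {V M : Type*} [Fintype V] [AddCommMonoid M]
    (P : V → V → Prop) [∀ v u, Decidable (P v u)] [Fintype {p : V × V // P p.1 p.2}]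
    (f : V → V → M) :
    ∑ x : {p : V × V // P p.1 p.2}, f x.1.1 x.1.2 =
      ∑ v : V, ∑ u : V, if P v u then f v u else 0 := by
  rw [← Fintype.sum_prod_type' (f := fun v u => if P v u then f v u else 0),
    ← Finset.sum_filter]
  exact (Finset.sum_subtype _ (by simp) (fun p : V × V => f p.1 p.2)).symm

/-- The vertex of `G` on whose side a vertex of `G''` has to lie. -/
def sbHome {V : Type*} (G : SimpleGraph V) [LinearOrder V] (s t : V) : SBV G s t → V
  | Sum.inl (Sum.inl v) => v
  | Sum.inl (Sum.inr a) => a.1.1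
  | Sum.inr j => j.1.2

/-- The side of `V(G'')` induced by a side of `V(G)`. -/
def sbLift {V : Type*} [Fintype V] [LinearOrder V] (G : SimpleGraph V)
    [DecidableRel G.Adj] (s t : V)
    (Vs : Finset V) : Finset (SBV G s t) :=
  Finset.univ.filter (fun x => sbHome G s t x ∈ Vs)

theorem mem_sbLift {V : Type*} [Fintype V] [LinearOrder V] (G : SimpleGraph V)
    [DecidableRel G.Adj] (s t : V)
    (Vs : Finset V) (x : SBV G s t) : x ∈ sbLift G s t Vs ↔ sbHome G s t x ∈ Vs := by
  simp [sbLift]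

theorem card_sbLift {V : Type*} [Fintype V] [LinearOrder V] (G : SimpleGraph V)
    [DecidableRel G.Adj] (s t : V)
    (hmin : ∀ v, s ≤ v) (hnadj : ¬ G.Adj s t)
    (hsadj : ∀ v, v ≠ s → v ≠ t → G.Adj s v)
    (d : ℕ) (hdeg : ∀ v, v ≠ s → v ≠ t → G.degree v = d)
    (Vs : Finset V) (hs : s ∈ Vs) (ht : t ∉ Vs) :
    (sbLift G s t Vs).card =
      Vs.card + (Finset.univ.filter (fun v : V => v ≠ s ∧ v ≠ t)).card
        + d * (Vs.card - 1) := by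
  have split : (sbLift G s t Vs).card = Vs.card + ∑ v ∈ Vs,
      ((∑ u : V, if G.Adj v u ∧ v < u then 1 else 0) +
       ∑ u : V, if (G.Adj u v ∧ u < v) ∧ v ≠ s ∧ v ≠ t then 1 else 0) := by
    rw [sbLift, Finset.card_filter, Fintype.sum_sum_type, Fintype.sum_sum_type, add_assoc,
      Finset.sum_add_distrib]
    change (∑ v : V, if v ∈ Vs then 1 else 0) + ((∑ a : SBArc G, if a.1.1 ∈ Vs then 1 else 0) +
      ∑ j : SBJ G s t, if j.1.2 ∈ Vs then 1 else 0) = _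
    congr 1
    · simp
    · congr 1
      · rw [Fintype.sum_subtype_eq_sum_sum_ite (fun v u => G.Adj v u ∧ v < u)
            (fun v _ => if v ∈ Vs then 1 else 0),
          ← Finset.sum_filter_add_sum_filter_not Finset.univ (fun v => v ∈ Vs)]
        rw [Finset.sum_eq_zero (s := Finset.univ.filter (fun v => v ∉ Vs)), add_zero]
        · refine Finset.sum_congr (by ext; simp) fun v hv => ?_
          simp [hv]
        · intro v hv
          simp only [Finset.mem_filter, Finset.mem_univ, true_and] at hv
          simp [hv]
      · rw [Fintype.sum_subtype_eq_sum_sum_ite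
            (fun u v => (G.Adj u v ∧ u < v) ∧ v ≠ s ∧ v ≠ t)
            (fun _ v => if v ∈ Vs then 1 else 0),
          Finset.sum_comm, ← Finset.sum_filter_add_sum_filter_not Finset.univ (fun v => v ∈ Vs)]
        rw [Finset.sum_eq_zero (s := Finset.univ.filter (fun v => v ∉ Vs)), add_zero]
        · refine Finset.sum_congr (by ext; simp) fun v hv => ?_
          simp [hv]
        · intro v hv
          simp only [Finset.mem_filter, Finset.mem_univ, true_and] at hv
          simp [hv]
  have hsrc : ((∑ u : V, if G.Adj s u ∧ s < u then 1 else 0) +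
      ∑ u : V, if (G.Adj u s ∧ u < s) ∧ s ≠ s ∧ s ≠ t then 1 else 0) =
      (Finset.univ.filter (fun v : V => v ≠ s ∧ v ≠ t)).card := by
    simp only [ne_eq, not_true_eq_false, false_and, and_false, if_false,
      Finset.sum_const_zero, add_zero, Finset.card_filter]
    refine Finset.sum_congr rfl fun u _ => if_congr ⟨fun h => ⟨h.2.ne', ?_⟩, fun h =>
      ⟨hsadj u h.1 h.2, lt_of_le_of_ne (hmin u) (Ne.symm h.1)⟩⟩ rfl rfl
    rintro rfl
    exact hnadj h.1
  have hinner : ∀ v ∈ Vs.erase s, ((∑ u : V, if G.Adj v u ∧ v < u then 1 else 0) +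
      ∑ u : V, if (G.Adj u v ∧ u < v) ∧ v ≠ s ∧ v ≠ t then 1 else 0) = d := by
    intro v hv
    have hvs : v ≠ s := Finset.ne_of_mem_erase hv
    have hvt : v ≠ t := fun h => ht (h ▸ Finset.mem_of_mem_erase hv)
    rw [← hdeg v hvs hvt, ← SimpleGraph.card_neighborFinset_eq_degree,
      SimpleGraph.neighborFinset_eq_filter, Finset.card_filter, ← Finset.sum_add_distrib]
    refine Finset.sum_congr rfl fun u _ => ?_
    by_cases h : G.Adj v u
    · rcases lt_or_gt_of_ne h.ne with hlt | hlt
      · simp [h, hlt, hlt.not_gt]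
      · simp [h, h.symm, hlt, hlt.not_gt, hvs, hvt]
    · simp [h, G.adj_comm u v]
  rw [split, ← Finset.add_sum_erase _ _ hs, hsrc, Finset.sum_congr rfl hinner,
    Finset.sum_const, Finset.card_erase_of_mem hs, smul_eq_mul, mul_comm d, add_assoc]

theorem sum_ite_sbQ {V : Type*} [Fintype V] [LinearOrder V] (G : SimpleGraph V)
    [DecidableRel G.Adj] (s t : V) (w : Sym2 V → NNReal) (R : V → V → Prop)
    [∀ v u, Decidable (R v u)]
    {C : SBV G s t → Prop}
    (hV : ∀ v, ¬ C (Sum.inl (Sum.inl v))) (hJ : ∀ j, ¬ C (Sum.inr j))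
    (hA : ∀ a : SBArc G, C (Sum.inl (Sum.inr a)) ↔ R a.1.1 a.1.2) [DecidablePred C] :
    (∑ x : SBV G s t, if C x then sbQ G s t w x else 0) =
      ∑ v : V, ∑ u : V, if G.Adj v u ∧ v < u then
        (if R v u then (w s(v, u) : ENNReal) else 0) else 0 := by
  rw [Fintype.sum_sum_type, Fintype.sum_sum_type,
    Finset.sum_eq_zero fun v _ => if_neg (hV v), Finset.sum_eq_zero fun j _ => if_neg (hJ j),
    zero_add, add_zero]
  exact (Finset.sum_congr rfl fun a _ => if_congr (hA a) rfl rfl).trans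
    (Fintype.sum_subtype_eq_sum_sum_ite (fun v u => G.Adj v u ∧ v < u)
      (fun v u => if R v u then (w s(v, u) : ENNReal) else 0))

theorem biTransfer_sbLift {V : Type*} [Fintype V] [LinearOrder V] (G : SimpleGraph V)
    [DecidableRel G.Adj] (s t : V) (Vs : Finset V) (w : Sym2 V → NNReal) :
    biTransfer (sbArcRel G s t) (↑(sbLift G s t Vs)) (sbQ G s t w) =
      ∑ v ∈ Vs, ∑ u ∈ Vsᶜ, if G.Adj v u then (w s(v, u) : ENNReal) else 0 := by
  have hcut : (∑ v ∈ Vs, ∑ u ∈ Vsᶜ, if G.Adj v u then (w s(v, u) : ENNReal) else 0) =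
      ∑ v : V, ∑ u : V, if v ∈ Vs ∧ u ∉ Vs ∧ G.Adj v u then (w s(v, u) : ENNReal) else 0 := by
    rw [← Finset.sum_subset (Finset.subset_univ Vs)]
    · refine Finset.sum_congr rfl fun v hv => ?_
      rw [← Finset.sum_subset (Finset.subset_univ Vsᶜ)]
      · refine Finset.sum_congr rfl fun u hu => ?_
        simp [hv, Finset.mem_compl.1 hu]
      · intro u _ hu
        simp_all
    · intro v _ hv
      simp [hv]
  have hrel : ∀ (v : V) (x : SBV G s t), sbArcRel G s t (Sum.inl (Sum.inl v)) x →
      sbHome G s t x = v := by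
    rintro v ((u | a) | j) h
    exacts [h.elim, h, h]
  have harc : ∀ (a : SBArc G) (x : SBV G s t), sbArcRel G s t (Sum.inl (Sum.inr a)) x ↔
      x = Sum.inl (Sum.inl a.1.2) := by
    rintro a ((u | b) | j) <;> simp [sbArcRel, eq_comm]
  have hJ : ∀ (j : SBJ G s t) (x : SBV G s t), ¬ sbArcRel G s t (Sum.inr j) x :=
    fun _ _ h => h
  rw [hcut, biTransfer,
    sum_ite_sbQ G s t w (fun v u => v ∈ Vs ∧ u ∉ Vs),
    sum_ite_sbQ G s t w (fun v u => v ∉ Vs ∧ u ∈ Vs),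
    Finset.sum_comm (f := fun v u => if G.Adj v u ∧ v < u then
      (if v ∉ Vs ∧ u ∈ Vs then (w s(v, u) : ENNReal) else 0) else 0),
    ← Finset.sum_add_distrib]
  rotate_left
  · rintro v ⟨hv, x, hx, hxv⟩
    rw [Finset.mem_coe, mem_sbLift] at hv hxv
    exact hv (hrel v x hx ▸ hxv)
  · rintro j ⟨-, x, hx, -⟩
    exact hJ j x hx
  · intro a
    simp [harc, mem_sbLift, sbHome]
  · rintro v ⟨hv, x, hx, hxv⟩
    rw [Finset.mem_coe, mem_sbLift] at hv hxv
    exact hxv ((hrel v x hx).symm ▸ hv)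
  · rintro j ⟨-, x, hx, -⟩
    exact hJ j x hx
  · intro a
    simp [harc, mem_sbLift, sbHome]
  refine Finset.sum_congr rfl fun v _ => ?_
  rw [← Finset.sum_add_distrib]
  refine Finset.sum_congr rfl fun u _ => ?_
  by_cases h : G.Adj v u
  · rcases lt_or_gt_of_ne h.ne with hlt | hlt
    · simp [h, hlt, hlt.not_gt]
    · simp [h, h.symm, hlt, hlt.not_gt, Sym2.eq_swap, and_comm]
  · simp [h, G.adj_comm u v]

theorem sum_sbP1_eq_zero {V : Type*} [LinearOrder V] (G : SimpleGraph V) (s t : V)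
    (S : Finset (SBV G s t)) (ht : (Sum.inl (Sum.inl t) : SBV G s t) ∉ S) :
    ∑ x ∈ S, sbP1 G s t x = 0 :=
  Finset.sum_eq_zero fun x hx => if_neg fun h : x = Sum.inl (Sum.inl t) => ht (h ▸ hx)

theorem sum_sbP2_eq_zero {V : Type*} [LinearOrder V] (G : SimpleGraph V) (s t : V)
    (S : Finset (SBV G s t)) (hs : (Sum.inl (Sum.inl s) : SBV G s t) ∉ S) :
    ∑ x ∈ S, sbP2 G s t x = 0 :=
  Finset.sum_eq_zero fun x hx => if_neg fun h : x = Sum.inl (Sum.inl s) => hs (h ▸ hx)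

theorem mem_iff_mem_of_biTransfer_ne_top {W : Type*} [Fintype W] {A : W → W → Prop}
    {V1 : Set W} {q : W → ENNReal} (h : biTransfer A V1 q ≠ ⊤) {x y : W} (hq : q x = ⊤)
    (hA : A x y) : x ∈ V1 ↔ y ∈ V1 := by
  rw [biTransfer, ENNReal.add_ne_top, ENNReal.sum_ne_top, ENNReal.sum_ne_top] at h
  constructor
  · intro hx
    by_contra hy
    exact h.1 x (Finset.mem_univ x) (by rw [if_pos ⟨hx, y, hA, hy⟩, hq])
  · intro hy
    by_contra hx
    exact h.2 x (Finset.mem_univ x) (by rw [if_pos ⟨hx, y, hA, hy⟩, hq])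

theorem eq_sbLift_of_biTransfer_ne_top {V : Type*} [Fintype V] [LinearOrder V]
    (G : SimpleGraph V) [DecidableRel G.Adj] (s t : V) (w : Sym2 V → NNReal) (V1 : Finset (SBV G s t))
    (h : biTransfer (sbArcRel G s t) (↑V1) (sbQ G s t w) ≠ ⊤) :
    V1 = sbLift G s t (Finset.univ.filter fun v => (Sum.inl (Sum.inl v) : SBV G s t) ∈ V1) := by
  ext x
  simp only [mem_sbLift, Finset.mem_filter, Finset.mem_univ, true_and]
  rcases x with (v | a) | j
  · rfl
  · exact (mem_iff_mem_of_biTransfer_ne_top h (x := Sum.inl (Sum.inl a.1.1))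
      (y := Sum.inl (Sum.inr a)) rfl rfl).symm
  · exact (mem_iff_mem_of_biTransfer_ne_top h (x := Sum.inl (Sum.inl j.1.2))
      (y := Sum.inr j) rfl rfl).symm

theorem stmt18 {V : Type*} [Fintype V] [LinearOrder V] (G : SimpleGraph V)
    [DecidableRel G.Adj] (s t : V) (hst : s ≠ t)
    (hmin : ∀ v, s ≤ v) (hmax : ∀ v, v ≤ t)
    (hnadj : ¬ G.Adj s t)
    (hsadj : ∀ v, v ≠ s → v ≠ t → G.Adj s v)
    (htadj : ∀ v, v ≠ s → v ≠ t → G.Adj t v)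
    (d : ℕ) (hdeg : ∀ v, v ≠ s → v ≠ t → G.degree v = d)
    (ℓ : ℕ) (hℓ : 1 ≤ ℓ)
    (w : Sym2 V → NNReal) (r : NNReal) :
    (∃ Vs : Finset V, s ∈ Vs ∧ t ∉ Vs ∧ Vs.card ≤ ℓ ∧
      (∑ v ∈ Vs, ∑ u ∈ Vsᶜ,
        if G.Adj v u then (w s(v, u) : ENNReal) else 0) ≤ (r : ENNReal))
    ↔
    (∃ V1 : Finset (SBV G s t),
      V1.card ≤ ℓ + (Finset.univ.filter (fun v : V => v ≠ s ∧ v ≠ t)).card + d * (ℓ - 1)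
      ∧ (∑ x ∈ V1, sbP1 G s t x) + (∑ x ∈ V1ᶜ, sbP2 G s t x)
          + biTransfer (sbArcRel G s t) (↑V1) (sbQ G s t w) ≤ (r : ENNReal)) := by
  constructor
  · rintro ⟨Vs, hs, ht, hcard, hcut⟩
    refine ⟨sbLift G s t Vs, ?_, ?_⟩
    · rw [card_sbLift G s t hmin hnadj hsadj d hdeg Vs hs ht]
      gcongr
    · rw [sum_sbP1_eq_zero G s t _ (by rwa [mem_sbLift]),
        sum_sbP2_eq_zero G s t _ (by simpa [mem_sbLift, sbHome] using hs), zero_add, zero_add,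
        biTransfer_sbLift]
      exact hcut
  · rintro ⟨V1, hcard, hcost⟩
    have hfin := ne_top_of_le_ne_top ENNReal.coe_ne_top hcost
    rw [ENNReal.add_ne_top, ENNReal.add_ne_top, ENNReal.sum_ne_top, ENNReal.sum_ne_top] at hfin
    obtain ⟨⟨hp1, hp2⟩, hΔ⟩ := hfin
    have ht : (Sum.inl (Sum.inl t) : SBV G s t) ∉ V1 := fun h => hp1 _ h (by simp [sbP1])
    have hs : (Sum.inl (Sum.inl s) : SBV G s t) ∈ V1 := by
      by_contra h
      exact hp2 _ (Finset.mem_compl.2 h) (by simp [sbP2])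
    have hlift := eq_sbLift_of_biTransfer_ne_top G s t w V1 hΔ
    set Vs : Finset V := Finset.univ.filter fun v => (Sum.inl (Sum.inl v) : SBV G s t) ∈ V1 with hVs
    have hs' : s ∈ Vs := by simpa [hVs] using hs
    have ht' : t ∉ Vs := by simpa [hVs] using ht
    refine ⟨Vs, hs', ht', ?_, ?_⟩
    · rw [hlift, card_sbLift G s t hmin hnadj hsadj d hdeg Vs hs' ht'] at hcard
      by_contra! hlt
      have := Nat.mul_le_mul_left d (Nat.sub_le_sub_right hlt.le 1)
      omega
    · rw [← biTransfer_sbLift G s t, ← hlift]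
      exact le_add_self.trans hcost
end
end

section
/- In the size-bounded construction, define q: V(G'') → [0,∞] by q(v) = ∞ for v ∈ V(G), q(a(v,u)) = w({v,u}) for every subdivision vertex a(v,u), and q(a) = 0 for every a ∈ J(v); define p: V(G'') × {1,2} → [0,∞] by p(s,2) = p(t,1) = ∞ and p(x,i) = 0 for all other pairs (x,i). Let r ∈ [0,∞) and let (V₁,V₂) be a bipartition of V(G'') with Σ_{v∈V₁} p(v,1) + Σ_{v∈V₂} p(v,2) + Δ((V₁,V₂),q,G'') ≤ r. Then s ∈ V₁ and t ∈ V₂; every subdivision vertex a(v,u) lies in the same part of (V₁,V₂) as v, and every vertex of J(v) lies in the same part as v; and Δ((V₁,V₂),q,G'') equals the total weight Σ w({v,u}) over edges {v,u} of G with one endpoint in V₁ ∩ V(G) and the other in V₂ ∩ V(G). -/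
open scoped Classical
open Finset

noncomputable section

/-- A finite sum of extended nonnegative reals that is not `⊤` has no term equal to `⊤` among the
indices satisfying the condition. -/
theorem ne_top_of_sum_ite_ne_top {W : Type*} [Fintype W] {P : W → Prop} [DecidablePred P]
    {f : W → ENNReal} (h : (∑ x : W, if P x then f x else 0) ≠ ⊤) {x : W} (hx : P x) :
    f x ≠ ⊤ := by
  have := ENNReal.sum_ne_top.1 h x (mem_univ x)
  rwa [if_pos hx] at this

/-- A symmetrised sum over pairs: the off-diagonal sum of `F` over ordered pairs is the sum over
increasing pairs of the two values of `F`. -/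
theorem sum_sum_eq_sum_sum_lt {V : Type*} [Fintype V] [LinearOrder V] (F : V → V → ENNReal)
    (hF : ∀ v, F v v = 0) :
    ∑ v, ∑ u, F v u = ∑ v, ∑ u, if v < u then F v u + F u v else 0 := by
  have h1 : ∀ v u, F v u = (if v < u then F v u else 0) + (if u < v then F v u else 0) := by
    intro v u
    rcases lt_trichotomy v u with h | h | h
    · simp [h, h.not_gt]
    · subst h; simp [hF]
    · simp [h, h.not_gt]
  have h2 : ∀ v u, (if v < u then F v u + F u v else 0)
      = (if v < u then F v u else 0) + (if v < u then F u v else 0) := by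
    intro v u; split_ifs <;> simp
  rw [sum_congr rfl fun v _ => sum_congr rfl fun u _ => h1 v u,
    sum_congr rfl fun v _ => sum_congr rfl fun u _ => h2 v u]
  simp only [sum_add_distrib]
  congr 1
  exact sum_comm

/-- A sum over the arcs of the orientation of `G` is a sum over increasing adjacent pairs. -/
theorem sum_sbArc {V : Type*} [Fintype V] [LinearOrder V] (G : SimpleGraph V)
    [Fintype (SBArc G)] (f : V → V → ENNReal) :
    ∑ a : SBArc G, f a.1.1 a.1.2 = ∑ v, ∑ u, if G.Adj v u ∧ v < u then f v u else 0 := by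
  rw [← Fintype.sum_prod_type' (f := fun v u => if G.Adj v u ∧ v < u then f v u else 0),
    ← sum_filter]
  exact (Finset.sum_subtype (univ.filter fun p : V × V => G.Adj p.1 p.2 ∧ p.1 < p.2)
    (by simp) (fun p => f p.1 p.2)).symm

theorem stmt19 {V : Type*} [Fintype V] [LinearOrder V] (G : SimpleGraph V)
    [DecidableRel G.Adj] (s t : V) (hst : s ≠ t)
    (hmin : ∀ v, s ≤ v) (hmax : ∀ v, v ≤ t)
    (hnadj : ¬ G.Adj s t)
    (hsadj : ∀ v, v ≠ s → v ≠ t → G.Adj s v)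
    (htadj : ∀ v, v ≠ s → v ≠ t → G.Adj t v)
    (d : ℕ) (hdeg : ∀ v, v ≠ s → v ≠ t → G.degree v = d)
    (ℓ : ℕ) (hℓ : 1 ≤ ℓ)
    (w : Sym2 V → NNReal) (r : NNReal)
    (V1 : Set (SBV G s t))
    (hle : (∑ x : SBV G s t, if x ∈ V1 then sbP1 G s t x else 0)
        + (∑ x : SBV G s t, if x ∉ V1 then sbP2 G s t x else 0)
        + biTransfer (sbArcRel G s t) V1 (sbQ G s t w) ≤ (r : ENNReal)) :
    (Sum.inl (Sum.inl s) ∈ V1)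
    ∧ (Sum.inl (Sum.inl t) ∉ V1)
    ∧ (∀ a : SBArc G, (Sum.inl (Sum.inr a) ∈ V1 ↔ Sum.inl (Sum.inl a.1.1) ∈ V1))
    ∧ (∀ j : SBJ G s t, (Sum.inr j ∈ V1 ↔ Sum.inl (Sum.inl j.1.2) ∈ V1))
    ∧ biTransfer (sbArcRel G s t) V1 (sbQ G s t w)
        = ∑ v : V, ∑ u : V,
            if G.Adj v u ∧ Sum.inl (Sum.inl v) ∈ V1 ∧ Sum.inl (Sum.inl u) ∉ V1
            then (w s(v, u) : ENNReal) else 0 := by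
  have htot := ne_top_of_le_ne_top ENNReal.coe_ne_top hle
  obtain ⟨hp, hb⟩ := ENNReal.add_ne_top.1 htot
  obtain ⟨hp1, hp2⟩ := ENNReal.add_ne_top.1 hp
  obtain ⟨hb1, hb2⟩ := ENNReal.add_ne_top.1 hb
  have hs : (Sum.inl (Sum.inl s) : SBV G s t) ∈ V1 := by
    by_contra h
    exact ne_top_of_sum_ite_ne_top hp2 h (by simp [sbP2])
  have ht : (Sum.inl (Sum.inl t) : SBV G s t) ∉ V1 := by
    intro h
    exact ne_top_of_sum_ite_ne_top hp1 h (by simp [sbP1])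
  have hout : ∀ (v : V) (x : SBV G s t), sbArcRel G s t (Sum.inl (Sum.inl v)) x →
      (x ∈ V1 ↔ Sum.inl (Sum.inl v) ∈ V1) := by
    intro v x hx
    constructor
    · intro h
      by_contra hv
      exact ne_top_of_sum_ite_ne_top hb2 (x := Sum.inl (Sum.inl v)) ⟨hv, x, hx, h⟩ rfl
    · intro hv
      by_contra h
      exact ne_top_of_sum_ite_ne_top hb1 (x := Sum.inl (Sum.inl v)) ⟨hv, x, hx, h⟩ rfl
  have ha : ∀ a : SBArc G, ((Sum.inl (Sum.inr a) : SBV G s t) ∈ V1 ↔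
      Sum.inl (Sum.inl a.1.1) ∈ V1) := fun a => hout _ _ rfl
  refine ⟨hs, ht, ha, fun j => hout _ _ rfl, ?_⟩
  have hnot1 : ∀ v : V, ¬ ((Sum.inl (Sum.inl v) : SBV G s t) ∈ V1 ∧
      ∃ u, sbArcRel G s t (Sum.inl (Sum.inl v)) u ∧ u ∉ V1) := by
    rintro v ⟨hv, u, hu, h⟩
    exact h ((hout v u hu).2 hv)
  have hnot2 : ∀ v : V, ¬ ((Sum.inl (Sum.inl v) : SBV G s t) ∉ V1 ∧
      ∃ u, sbArcRel G s t (Sum.inl (Sum.inl v)) u ∧ u ∈ V1) := by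
    rintro v ⟨hv, u, hu, h⟩
    exact hv ((hout v u hu).1 h)
  have harc : ∀ (a : SBArc G) (P : SBV G s t → Prop),
      (∃ u, sbArcRel G s t (Sum.inl (Sum.inr a)) u ∧ P u) ↔ P (Sum.inl (Sum.inl a.1.2)) := by
    intro a P
    constructor
    · rintro ⟨(u | b) | j, hu, h⟩
      · obtain rfl : a.1.2 = u := hu
        exact h
      · exact hu.elim
      · exact hu.elim
    · exact fun h => ⟨Sum.inl (Sum.inl a.1.2), rfl, h⟩
  rw [sum_sum_eq_sum_sum_lt _ (by simp), biTransfer]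
  simp only [Fintype.sum_sum_type, hnot1, hnot2, if_false, sum_const_zero, zero_add, sbQ, ite_self,
    add_zero, harc _ (fun u => u ∉ V1), harc _ (fun u => u ∈ V1), ha]
  rw [← sum_add_distrib]
  refine (sum_sbArc G fun v u =>
    (if (Sum.inl (Sum.inl v) : SBV G s t) ∈ V1 ∧ (Sum.inl (Sum.inl u) : SBV G s t) ∉ V1
      then (w s(v, u) : ENNReal) else 0) +
    (if (Sum.inl (Sum.inl v) : SBV G s t) ∉ V1 ∧ (Sum.inl (Sum.inl u) : SBV G s t) ∈ V1
      then (w s(v, u) : ENNReal) else 0)).trans ?_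
  refine sum_congr rfl fun v _ => sum_congr rfl fun u _ => ?_
  by_cases hvu : v < u
  · by_cases hadj : G.Adj v u
    · simp [hvu, hadj, hadj.symm, Sym2.eq_swap (a := u) (b := v), and_comm]
    · simp [hadj, G.adj_comm u v]
  · simp [hvu]
end
end
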